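/- arXiv:2206.01657 — 2 statements merged into one kernel-verified Lean document; each statement's English description precedes it below -/
import Mathlib

section
/- Let ς_1,…,ς_κ ∈ ℂ be such that K(ς_i) and K̂(ς_i) = Wᴴ K(ς_i) V are invertible for all i = 1,…,κ, let c ∈ ℂ^p be a tangential direction, and let δ^{(1)},…,δ^{(κ-1)} ∈ ℂ^m be scaling vectors. Define recursively w_1 = K(ς_κ)^{-ᴴ} C(ς_κ)ᴴ c and w_i = K(ς_{κ-i+1})^{-ᴴ} 𝔑(ς_{κ-i+1}, δ^{(κ-i+1)})ᴴ w_{i-1} for 2 ≤ i ≤ κ. If w_1,…,w_κ all lie in the column space of W, then for every 1 ≤ η ≤ κ the left tangential interpolation conditions cᴴ 𝔾_η(ς_{κ-η+1},…,ς_κ | δ^{(κ-η+1)},…,δ^{(κ-1)}) = cᴴ 𝔾̂_η(ς_{κ-η+1},…,ς_κ | δ^{(κ-η+1)},…,δ^{(κ-1)}) hold. -/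
open Matrix
open scoped Kronecker

namespace StructBilin

/-- Scaled sum of the bilinear terms: `𝔑(s, d) = ∑ i, d i • N i s`. -/
noncomputable def Nsum {n m : ℕ} (N : Fin m → ℂ → Matrix (Fin n) (Fin n) ℂ) (s : ℂ)
    (d : Fin m → ℂ) : Matrix (Fin n) (Fin n) ℂ :=
  ∑ i, d i • N i s

/-- Middle factor of the modified transfer function
`𝔾_{q+1}(σ 0, …, σ q | d 0, …, d (q-1)) = C (σ q) * gAux K B N σ d q`. -/
noncomputable def gAux {n m : ℕ} (K : ℂ → Matrix (Fin n) (Fin n) ℂ)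
    (B : ℂ → Matrix (Fin n) (Fin m) ℂ) (N : Fin m → ℂ → Matrix (Fin n) (Fin n) ℂ)
    (σ : ℕ → ℂ) (d : ℕ → Fin m → ℂ) : ℕ → Matrix (Fin n) (Fin m) ℂ
  | 0 => (K (σ 0))⁻¹ * B (σ 0)
  | j + 1 => (K (σ (j + 1)))⁻¹ * Nsum N (σ j) (d j) * gAux K B N σ d j

/-- The modified (scaled and summed) transfer function
`𝔾_{q+1}(σ 0, …, σ q | d 0, …, d (q-1))` (the level is `q + 1`, indices are 0-based). -/
noncomputable def Gmod {n m p : ℕ} (C : ℂ → Matrix (Fin p) (Fin n) ℂ)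
    (K : ℂ → Matrix (Fin n) (Fin n) ℂ) (B : ℂ → Matrix (Fin n) (Fin m) ℂ)
    (N : Fin m → ℂ → Matrix (Fin n) (Fin n) ℂ) (σ : ℕ → ℂ) (d : ℕ → Fin m → ℂ)
    (q : ℕ) : Matrix (Fin p) (Fin m) ℂ :=
  C (σ q) * gAux K B N σ d q

/-- Right tangential interpolation vectors:
`v 0 = K(σ 0)⁻¹ B(σ 0) b`, `v (j+1) = K(σ (j+1))⁻¹ 𝔑(σ j, d j) v j`. -/
noncomputable def vtan {n m : ℕ} (K : ℂ → Matrix (Fin n) (Fin n) ℂ)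
    (B : ℂ → Matrix (Fin n) (Fin m) ℂ) (N : Fin m → ℂ → Matrix (Fin n) (Fin n) ℂ)
    (σ : ℕ → ℂ) (d : ℕ → Fin m → ℂ) (b : Fin m → ℂ) : ℕ → Fin n → ℂ
  | 0 => (K (σ 0))⁻¹ *ᵥ (B (σ 0) *ᵥ b)
  | j + 1 => (K (σ (j + 1)))⁻¹ *ᵥ (Nsum N (σ j) (d j) *ᵥ vtan K B N σ d b j)

/-- Left tangential interpolation vectors (with reversed point sequence `τ` and
scaling sequence `e`):
`w 0 = K(τ 0)^{-ᴴ} C(τ 0)ᴴ c`, `w (t+1) = K(τ (t+1))^{-ᴴ} 𝔑(τ (t+1), e t)ᴴ w t`. -/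
noncomputable def wtan {n m p : ℕ} (C : ℂ → Matrix (Fin p) (Fin n) ℂ)
    (K : ℂ → Matrix (Fin n) (Fin n) ℂ) (N : Fin m → ℂ → Matrix (Fin n) (Fin n) ℂ)
    (τ : ℕ → ℂ) (e : ℕ → Fin m → ℂ) (c : Fin p → ℂ) : ℕ → Fin n → ℂ
  | 0 => ((K (τ 0))⁻¹)ᴴ *ᵥ ((C (τ 0))ᴴ *ᵥ c)
  | t + 1 => ((K (τ (t + 1)))⁻¹)ᴴ *ᵥ ((Nsum N (τ (t + 1)) (e t))ᴴ *ᵥ wtan C K N τ e c t)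

/-- Entrywise `t`-th complex derivative of a matrix-valued function. -/
noncomputable def mDeriv {α β : Type*} (t : ℕ) (f : ℂ → Matrix α β ℂ) (z : ℂ) :
    Matrix α β ℂ :=
  Matrix.of fun i j => iteratedDeriv t (fun w => f w i j) z

/-- Entrywise `t`-th complex derivative of a vector-valued function. -/
noncomputable def vDeriv {α : Type*} (t : ℕ) (f : ℂ → α → ℂ) (z : ℂ) : α → ℂ :=
  fun i => iteratedDeriv t (fun w => f w i) z

/-- Partial derivative in the `i`-th coordinate of a function of countably many
complex variables. -/
noncomputable def pD (i : ℕ) (f : (ℕ → ℂ) → ℂ) (s : ℕ → ℂ) : ℂ :=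
  deriv (fun z => f (Function.update s i z)) (s i)

/-- Mixed partial derivative `∂_{s_1^{ord 0} ⋯ s_t^{ord (t-1)}}` of a function of the
first `t` coordinates. -/
noncomputable def mixedD (ord : ℕ → ℕ) : ℕ → ((ℕ → ℂ) → ℂ) → (ℕ → ℂ) → ℂ
  | 0, f => f
  | t + 1, f => mixedD ord t ((pD t)^[ord t] f)

/-- The Hermite chain
`hChain t = ∂^{ℓ (t)}(𝔑(·, d t) K⁻¹)(σ t) ⋯ ∂^{ℓ 0}(𝔑(·, d 0) K⁻¹ B)(σ 0)`. -/
noncomputable def hChain {n m : ℕ} (K : ℂ → Matrix (Fin n) (Fin n) ℂ)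
    (B : ℂ → Matrix (Fin n) (Fin m) ℂ) (N : Fin m → ℂ → Matrix (Fin n) (Fin n) ℂ)
    (σ : ℕ → ℂ) (d : ℕ → Fin m → ℂ) (ℓ : ℕ → ℕ) : ℕ → Matrix (Fin n) (Fin m) ℂ
  | 0 => mDeriv (ℓ 0) (fun z => Nsum N z (d 0) * ((K z)⁻¹ * B z)) (σ 0)
  | t + 1 =>
      mDeriv (ℓ (t + 1)) (fun z => Nsum N z (d (t + 1)) * (K z)⁻¹) (σ (t + 1)) *
        hChain K B N σ d ℓ t

/-- Right tangential Hermite interpolation vectors. -/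
noncomputable def vHerm {n m : ℕ} (K : ℂ → Matrix (Fin n) (Fin n) ℂ)
    (B : ℂ → Matrix (Fin n) (Fin m) ℂ) (N : Fin m → ℂ → Matrix (Fin n) (Fin n) ℂ)
    (σ : ℕ → ℂ) (d : ℕ → Fin m → ℂ) (ℓ : ℕ → ℕ) (b : Fin m → ℂ) : ℕ → ℕ → Fin n → ℂ
  | 0, j => mDeriv j (fun z => (K z)⁻¹ * B z) (σ 0) *ᵥ b
  | t + 1, j => (mDeriv j (fun z => (K z)⁻¹) (σ (t + 1)) * hChain K B N σ d ℓ t) *ᵥ b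

/-- Left tangential Hermite interpolation vectors (with reversed sequences). -/
noncomputable def wHerm {n m p : ℕ} (C : ℂ → Matrix (Fin p) (Fin n) ℂ)
    (K : ℂ → Matrix (Fin n) (Fin n) ℂ) (N : Fin m → ℂ → Matrix (Fin n) (Fin n) ℂ)
    (τ : ℕ → ℂ) (e : ℕ → Fin m → ℂ) (eν : ℕ → ℕ) (c : Fin p → ℂ) : ℕ → ℕ → Fin n → ℂ
  | 0, i => star (vDeriv i (fun z => Matrix.vecMul (star c) (C z * (K z)⁻¹)) (τ 0))
  | t + 1, j =>
      star (vDeriv j (fun z =>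
        Matrix.vecMul (star (wHerm C K N τ e eν c t (eν t))) (Nsum N z (e t) * (K z)⁻¹))
        (τ (t + 1)))

/-- Column index type of the `j+1`-st subsystem transfer function (`m^(j+1)` indices). -/
def colT (m : ℕ) : ℕ → Type
  | 0 => Fin m
  | j + 1 => Fin m × colT m j

def colTFintype (m : ℕ) : ∀ j, Fintype (colT m j)
  | 0 => inferInstanceAs (Fintype (Fin m))
  | j + 1 => letI := colTFintype m j; inferInstanceAs (Fintype (Fin m × colT m j))

attribute [instance] colTFintype

/-- Block index type (`m^j` indices). -/
def outT (m : ℕ) : ℕ → Type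
  | 0 => Fin 1
  | j + 1 => Fin m × outT m j

def outTFintype (m : ℕ) : ∀ j, Fintype (outT m j)
  | 0 => inferInstanceAs (Fintype (Fin 1))
  | j + 1 => letI := outTFintype m j; inferInstanceAs (Fintype (Fin m × outT m j))

attribute [instance] outTFintype

/-- The horizontal concatenation `N(s) = [N_1(s) ⋯ N_m(s)]`. -/
noncomputable def Nbig {n m : ℕ} (N : Fin m → ℂ → Matrix (Fin n) (Fin n) ℂ) (s : ℂ) :
    Matrix (Fin n) (Fin m × Fin n) ℂ :=
  Matrix.of fun i q => N q.1 s i q.2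

/-- The vertical concatenation `Ñ(s)` of `N_1(s), …, N_m(s)`. -/
noncomputable def Ntil {n m : ℕ} (N : Fin m → ℂ → Matrix (Fin n) (Fin n) ℂ) (s : ℂ) :
    Matrix (Fin m × Fin n) (Fin n) ℂ :=
  Matrix.of fun q i => N q.1 s q.2 i

/-- State part of the `j+1`-st subsystem transfer function:
`Z 0 = K(σ 0)⁻¹ B(σ 0)`, `Z (j+1) = K(σ (j+1))⁻¹ N(σ j) (I_m ⊗ Z j)`. -/
noncomputable def Zblk {n m : ℕ} (K : ℂ → Matrix (Fin n) (Fin n) ℂ)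
    (B : ℂ → Matrix (Fin n) (Fin m) ℂ) (N : Fin m → ℂ → Matrix (Fin n) (Fin n) ℂ)
    (σ : ℕ → ℂ) : (j : ℕ) → Matrix (Fin n) (colT m j) ℂ
  | 0 => (K (σ 0))⁻¹ * B (σ 0)
  | j + 1 =>
      (K (σ (j + 1)))⁻¹ * Nbig N (σ j) *
        ((1 : Matrix (Fin m) (Fin m) ℂ) ⊗ₖ Zblk K B N σ j)

/-- The `q+1`-st subsystem transfer function `G_{q+1}(σ 0, …, σ q)`. -/
noncomputable def Gblk {n m p : ℕ} (C : ℂ → Matrix (Fin p) (Fin n) ℂ)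
    (K : ℂ → Matrix (Fin n) (Fin n) ℂ) (B : ℂ → Matrix (Fin n) (Fin m) ℂ)
    (N : Fin m → ℂ → Matrix (Fin n) (Fin n) ℂ) (σ : ℕ → ℂ) (q : ℕ) :
    Matrix (Fin p) (colT m q) ℂ :=
  C (σ q) * Zblk K B N σ q

/-- The tangential direction matrix `I_{m^j} ⊗ b`. -/
noncomputable def tangMat {m : ℕ} (b : Fin m → ℂ) :
    (j : ℕ) → Matrix (colT m j) (outT m j) ℂ
  | 0 => Matrix.of fun i _ => b i
  | j + 1 => (1 : Matrix (Fin m) (Fin m) ℂ) ⊗ₖ tangMat b j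

/-- Blockwise right interpolation matrices:
`V 0 = K(σ 0)⁻¹ B(σ 0) b`, `V (j+1) = K(σ (j+1))⁻¹ N(σ j) (I_m ⊗ V j)`. -/
noncomputable def Vblk {n m : ℕ} (K : ℂ → Matrix (Fin n) (Fin n) ℂ)
    (B : ℂ → Matrix (Fin n) (Fin m) ℂ) (N : Fin m → ℂ → Matrix (Fin n) (Fin n) ℂ)
    (σ : ℕ → ℂ) (b : Fin m → ℂ) : (j : ℕ) → Matrix (Fin n) (outT m j) ℂ
  | 0 => Matrix.of fun i _ => ((K (σ 0))⁻¹ *ᵥ (B (σ 0) *ᵥ b)) i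
  | j + 1 =>
      (K (σ (j + 1)))⁻¹ * Nbig N (σ j) *
        ((1 : Matrix (Fin m) (Fin m) ℂ) ⊗ₖ Vblk K B N σ b j)

/-- Blockwise left interpolation matrices (with reversed point sequence `τ`):
`W 0 = K(τ 0)^{-ᴴ} C(τ 0)ᴴ c`, `W (t+1) = K(τ (t+1))^{-ᴴ} Ñ(τ (t+1))ᴴ (I_m ⊗ W t)`. -/
noncomputable def Wblk {n m p : ℕ} (C : ℂ → Matrix (Fin p) (Fin n) ℂ)
    (K : ℂ → Matrix (Fin n) (Fin n) ℂ) (N : Fin m → ℂ → Matrix (Fin n) (Fin n) ℂ)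
    (τ : ℕ → ℂ) (c : Fin p → ℂ) : (t : ℕ) → Matrix (Fin n) (outT m t) ℂ
  | 0 => Matrix.of fun i _ => (((K (τ 0))⁻¹)ᴴ *ᵥ ((C (τ 0))ᴴ *ᵥ c)) i
  | t + 1 =>
      ((K (τ (t + 1)))⁻¹)ᴴ * (Ntil N (τ (t + 1)))ᴴ *
        ((1 : Matrix (Fin m) (Fin m) ℂ) ⊗ₖ Wblk C K N τ c t)

/-- A vector as a one-column matrix. -/
noncomputable def bCol {m : ℕ} (b : Fin m → ℂ) : Matrix (Fin m) (Fin 1) ℂ :=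
  Matrix.of fun i _ => b i

/-- Blockwise Hermite chain. -/
noncomputable def hChainB {n m : ℕ} (K : ℂ → Matrix (Fin n) (Fin n) ℂ)
    (B : ℂ → Matrix (Fin n) (Fin m) ℂ) (N : Fin m → ℂ → Matrix (Fin n) (Fin n) ℂ)
    (σ : ℕ → ℂ) (ℓ : ℕ → ℕ) (b : Fin m → ℂ) :
    (t : ℕ) → Matrix (Fin n) (outT m (t + 1)) ℂ
  | 0 => mDeriv (ℓ 0)
      (fun z => Nbig N z * ((1 : Matrix (Fin m) (Fin m) ℂ) ⊗ₖ ((K z)⁻¹ * B z * bCol b)))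
      (σ 0)
  | t + 1 =>
      mDeriv (ℓ (t + 1))
        (fun z => Nbig N z * ((1 : Matrix (Fin m) (Fin m) ℂ) ⊗ₖ (K z)⁻¹)) (σ (t + 1)) *
        ((1 : Matrix (Fin m) (Fin m) ℂ) ⊗ₖ hChainB K B N σ ℓ b t)

/-- Blockwise right Hermite interpolation matrices. -/
noncomputable def vHermB {n m : ℕ} (K : ℂ → Matrix (Fin n) (Fin n) ℂ)
    (B : ℂ → Matrix (Fin n) (Fin m) ℂ) (N : Fin m → ℂ → Matrix (Fin n) (Fin n) ℂ)
    (σ : ℕ → ℂ) (ℓ : ℕ → ℕ) (b : Fin m → ℂ) : (t : ℕ) → ℕ → Matrix (Fin n) (outT m t) ℂ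
  | 0, j => mDeriv j (fun z => (K z)⁻¹ * B z * bCol b) (σ 0)
  | t + 1, j => mDeriv j (fun z => (K z)⁻¹) (σ (t + 1)) * hChainB K B N σ ℓ b t

/-- Blockwise left Hermite interpolation matrices (with reversed sequences). -/
noncomputable def wHermB {n m p : ℕ} (C : ℂ → Matrix (Fin p) (Fin n) ℂ)
    (K : ℂ → Matrix (Fin n) (Fin n) ℂ) (N : Fin m → ℂ → Matrix (Fin n) (Fin n) ℂ)
    (τ : ℕ → ℂ) (eν : ℕ → ℕ) (c : Fin p → ℂ) : (t : ℕ) → ℕ → Matrix (Fin n) (outT m t) ℂ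
  | 0, i => Matrix.of fun idx _ =>
      star (iteratedDeriv i (fun z => Matrix.vecMul (star c) (C z * (K z)⁻¹) idx) (τ 0))
  | t + 1, j => Matrix.of fun idx cc =>
      star (iteratedDeriv j (fun z =>
        (((1 : Matrix (Fin m) (Fin m) ℂ) ⊗ₖ wHermB C K N τ eν c t (eν t))ᴴ * Ntil N z *
          (K z)⁻¹) cc idx) (τ (t + 1)))

/-- The Kronecker product `d (j-1) ⊗ ⋯ ⊗ d 0 ⊗ I_m` of scaling vectors with the identity. -/
noncomputable def dKron {m : ℕ} (d : ℕ → Fin m → ℂ) :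
    (j : ℕ) → Matrix (colT m j) (Fin m) ℂ
  | 0 => (1 : Matrix (Fin m) (Fin m) ℂ)
  | j + 1 => Matrix.of fun (pq : Fin m × colT m j) cix => d j pq.1 * dKron d j pq.2 cix

/-- The innermost (input) coordinate of a column multi-index. -/
def innerIdx (m : ℕ) : (j : ℕ) → colT m j → Fin m
  | 0 => fun x => x
  | j + 1 => fun (pq : Fin m × colT m j) => innerIdx m j pq.2

/-- The chain `K(σ t)⁻¹ N_{J (t-1)}(σ (t-1)) ⋯ N_{J 0}(σ 0) K(σ 0)⁻¹ B(σ 0)`. -/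
noncomputable def eChain {n m : ℕ} (K : ℂ → Matrix (Fin n) (Fin n) ℂ)
    (B : ℂ → Matrix (Fin n) (Fin m) ℂ) (N : Fin m → ℂ → Matrix (Fin n) (Fin n) ℂ)
    (σ : ℕ → ℂ) (J : ℕ → Fin m) : ℕ → Matrix (Fin n) (Fin m) ℂ
  | 0 => (K (σ 0))⁻¹ * B (σ 0)
  | t + 1 => (K (σ (t + 1)))⁻¹ * N (J t) (σ t) * eChain K B N σ J t

theorem star_wtan_zero {n m p : ℕ} (C : ℂ → Matrix (Fin p) (Fin n) ℂ)
    (K : ℂ → Matrix (Fin n) (Fin n) ℂ) (N : Fin m → ℂ → Matrix (Fin n) (Fin n) ℂ)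
    (τ : ℕ → ℂ) (e : ℕ → Fin m → ℂ) (c : Fin p → ℂ) :
    star (wtan C K N τ e c 0) = star c ᵥ* (C (τ 0) * (K (τ 0))⁻¹) := by
  simp [wtan, star_mulVec]

theorem star_wtan_succ {n m p : ℕ} (C : ℂ → Matrix (Fin p) (Fin n) ℂ)
    (K : ℂ → Matrix (Fin n) (Fin n) ℂ) (N : Fin m → ℂ → Matrix (Fin n) (Fin n) ℂ)
    (τ : ℕ → ℂ) (e : ℕ → Fin m → ℂ) (c : Fin p → ℂ) (t : ℕ) :
    star (wtan C K N τ e c (t + 1)) =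
      star (wtan C K N τ e c t) ᵥ* (Nsum N (τ (t + 1)) (e t) * (K (τ (t + 1)))⁻¹) := by
  rw [wtan, star_mulVec, star_mulVec, conjTranspose_conjTranspose,
    conjTranspose_conjTranspose, vecMul_vecMul]

theorem Nsum_compress {n m r : ℕ} (N : Fin m → ℂ → Matrix (Fin n) (Fin n) ℂ)
    (V W : Matrix (Fin n) (Fin r) ℂ) (s : ℂ) (d : Fin m → ℂ) :
    Nsum (fun ι s => Wᴴ * N ι s * V) s d = Wᴴ * Nsum N s d * V := by
  simp [Nsum, Matrix.mul_sum, Matrix.sum_mul]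

/-- Peeling the chain from the left turns it into left tangential vectors. -/
theorem star_wtan_vecMul_gAux {n m p : ℕ} (C : ℂ → Matrix (Fin p) (Fin n) ℂ)
    (K : ℂ → Matrix (Fin n) (Fin n) ℂ) (B : ℂ → Matrix (Fin n) (Fin m) ℂ)
    (N : Fin m → ℂ → Matrix (Fin n) (Fin n) ℂ) (σ τ : ℕ → ℂ) (d e : ℕ → Fin m → ℂ)
    (c : Fin p → ℂ) (q : ℕ) (hσ : ∀ i j, i + j = q → σ j = τ i)
    (hd : ∀ i j, i + j + 1 = q → d j = e i) (j t : ℕ) (hjt : t + j + 1 = q) :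
    star (wtan C K N τ e c t) ᵥ* (Nsum N (σ j) (d j) * gAux K B N σ d j) =
      star (wtan C K N τ e c q) ᵥ* B (σ 0) := by
  induction j generalizing t with
  | zero =>
    subst hjt
    rw [gAux, hd t 0 rfl, hσ (t + 1) 0 rfl, ← Matrix.mul_assoc, ← vecMul_vecMul,
      ← star_wtan_succ]
  | succ j ih =>
    rw [← ih (t + 1) (by omega), star_wtan_succ, vecMul_vecMul, gAux, hd t (j + 1) hjt,
      hσ (t + 1) (j + 1) (by omega)]
    simp only [Matrix.mul_assoc]

theorem star_vecMul_Gmod {n m p : ℕ} (C : ℂ → Matrix (Fin p) (Fin n) ℂ)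
    (K : ℂ → Matrix (Fin n) (Fin n) ℂ) (B : ℂ → Matrix (Fin n) (Fin m) ℂ)
    (N : Fin m → ℂ → Matrix (Fin n) (Fin n) ℂ) (σ τ : ℕ → ℂ) (d e : ℕ → Fin m → ℂ)
    (c : Fin p → ℂ) (q : ℕ) (hσ : ∀ i j, i + j = q → σ j = τ i)
    (hd : ∀ i j, i + j + 1 = q → d j = e i) :
    star c ᵥ* Gmod C K B N σ d q = star (wtan C K N τ e c q) ᵥ* B (σ 0) := by
  cases q with
  | zero =>
    rw [star_wtan_zero, Gmod, gAux, hσ 0 0 rfl, vecMul_vecMul, Matrix.mul_assoc]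
  | succ q =>
    rw [← star_wtan_vecMul_gAux C K B N σ τ d e c (q + 1) hσ hd q 0 (by omega),
      star_wtan_zero, Gmod, gAux, hσ 0 (q + 1) (by omega), vecMul_vecMul]
    simp only [Matrix.mul_assoc]

/-- If `x` is the row vector `y K⁻¹` and `x = z Wᴴ`, then `z` solves the compressed system. -/
theorem vecMul_compress_inv {n r : ℕ} {K : Matrix (Fin n) (Fin n) ℂ}
    {V W : Matrix (Fin n) (Fin r) ℂ} (hK : IsUnit K.det) (hKr : IsUnit (Wᴴ * K * V).det)
    {y : Fin n → ℂ} {z : Fin r → ℂ} (h : y ᵥ* K⁻¹ = z ᵥ* Wᴴ) :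
    y ᵥ* V ᵥ* (Wᴴ * K * V)⁻¹ = z := by
  have hy : y = z ᵥ* (Wᴴ * K) := by
    rw [← vecMul_vecMul, ← h, vecMul_vecMul, nonsing_inv_mul _ hK, vecMul_one]
  rw [hy, vecMul_vecMul z, vecMul_vecMul, mul_nonsing_inv _ hKr, vecMul_one]

/-- The left tangential vectors lying in the range of `W` are the lifts of the left tangential
vectors of the projected system. -/
theorem star_wtan_compress {n m p r : ℕ} (C : ℂ → Matrix (Fin p) (Fin n) ℂ)
    (K : ℂ → Matrix (Fin n) (Fin n) ℂ) (N : Fin m → ℂ → Matrix (Fin n) (Fin n) ℂ)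
    (V W : Matrix (Fin n) (Fin r) ℂ) (τ : ℕ → ℂ) (e : ℕ → Fin m → ℂ) (c : Fin p → ℂ) (κ : ℕ)
    (hK : ∀ t < κ, IsUnit (K (τ t)).det) (hKr : ∀ t < κ, IsUnit (Wᴴ * K (τ t) * V).det)
    (hW : ∀ t < κ, wtan C K N τ e c t ∈ Set.range W.mulVec) (t : ℕ) (ht : t < κ) :
    star (wtan (fun s => C s * V) (fun s => Wᴴ * K s * V) (fun ι s => Wᴴ * N ι s * V) τ e c t)
      ᵥ* Wᴴ = star (wtan C K N τ e c t) := by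
  obtain ⟨z, hz⟩ := hW t ht
  have hz' : star (wtan C K N τ e c t) = star z ᵥ* Wᴴ := by rw [← hz, star_mulVec]
  rw [hz']
  congr 1
  induction t generalizing z with
  | zero =>
    rw [star_wtan_zero, ← vecMul_vecMul] at hz' ⊢
    rw [← vecMul_vecMul]
    exact vecMul_compress_inv (hK 0 ht) (hKr 0 ht) hz'
  | succ t ih =>
    obtain ⟨x, hx⟩ := hW t (by omega)
    have hx' : star (wtan C K N τ e c t) = star x ᵥ* Wᴴ := by rw [← hx, star_mulVec]
    rw [star_wtan_succ, ← vecMul_vecMul] at hz' ⊢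
    rw [ih (by omega) x hx hx', Nsum_compress, ← vecMul_vecMul, ← vecMul_vecMul, ← hx']
    exact vecMul_compress_inv (hK _ ht) (hKr _ ht) hz'

theorem stmt_1 {n m p r : ℕ} (hn : 0 < n) (hm : 0 < m) (hp : 0 < p) (hr : 0 < r)
    (C : ℂ → Matrix (Fin p) (Fin n) ℂ) (K : ℂ → Matrix (Fin n) (Fin n) ℂ)
    (B : ℂ → Matrix (Fin n) (Fin m) ℂ) (N : Fin m → ℂ → Matrix (Fin n) (Fin n) ℂ)
    (V W : Matrix (Fin n) (Fin r) ℂ)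
    (κ : ℕ) (hκ : 0 < κ) (ς : ℕ → ℂ) (δ : ℕ → Fin m → ℂ) (c : Fin p → ℂ)
    (hK : ∀ i < κ, IsUnit (K (ς i)).det)
    (hKr : ∀ i < κ, IsUnit (Wᴴ * K (ς i) * V).det)
    (hW : ∀ t < κ,
      wtan C K N (fun t => ς (κ - 1 - t)) (fun t => δ (κ - 2 - t)) c t ∈
        Set.range W.mulVec) :
    ∀ η < κ,
      Matrix.vecMul (star c)
          (Gmod C K B N (fun j => ς (κ - 1 - η + j)) (fun j => δ (κ - 1 - η + j)) η) =
        Matrix.vecMul (star c)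
          (Gmod (fun s => C s * V) (fun s => Wᴴ * K s * V) (fun s => Wᴴ * B s) (fun ι s => Wᴴ * N ι s * V) (fun j => ς (κ - 1 - η + j)) (fun j => δ (κ - 1 - η + j)) η) := by
  intro η hη
  have hσ : ∀ i j, i + j = η → ς (κ - 1 - η + j) = ς (κ - 1 - i) := by
    intro i j hij
    congr 1
    omega
  have hd : ∀ i j, i + j + 1 = η → δ (κ - 1 - η + j) = δ (κ - 2 - i) := by
    intro i j hij
    congr 1
    omega
  rw [star_vecMul_Gmod C K B N _ (fun t => ς (κ - 1 - t)) _ (fun t => δ (κ - 2 - t)) c η hσ hd,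
    star_vecMul_Gmod _ _ _ _ _ (fun t => ς (κ - 1 - t)) _ (fun t => δ (κ - 2 - t)) c η hσ hd,
    ← vecMul_vecMul,
    star_wtan_compress C K N V W _ _ c κ (fun t _ => hK _ (by omega))
      (fun t _ => hKr _ (by omega)) hW η hη]

end StructBilin
end

section
/- Suppose C, K, B, and all N_j are analytic at σ_1,…,σ_k ∈ ℂ and that K(σ_i) and K̂(σ_i) = Wᴴ K(σ_i) V are invertible for all i = 1,…,k. Let b ∈ ℂ^m, let d^{(1)},…,d^{(k-1)} ∈ ℂ^m, and let ℓ_1,…,ℓ_k be nonnegative integers. Define v_{1,j_1} = ∂_{s^{j_1}}(K^{-1}B)(σ_1) b for j_1 = 0,…,ℓ_1, and for 2 ≤ i ≤ k, v_{i,j_i} = ∂_{s^{j_i}}K^{-1}(σ_i) · ∂_{s^{ℓ_{i-1}}}(𝔑(·,d^{(i-1)}) K^{-1})(σ_{i-1}) ⋯ ∂_{s^{ℓ_2}}(𝔑(·,d^{(2)}) K^{-1})(σ_2) · ∂_{s^{ℓ_1}}(𝔑(·,d^{(1)}) K^{-1} B)(σ_1) b for j_i = 0,…,ℓ_i. If all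 the vectors v_{i,j_i} lie in the column space of V, then for every 1 ≤ q ≤ k and every j_q = 0,…,ℓ_q the tangential Hermite interpolation conditions ∂_{s_1^{ℓ_1} ⋯ s_{q-1}^{ℓ_{q-1}} s_q^{j_q}} 𝔾_q(σ_1,…,σ_q | d^{(1)},…,d^{(q-1)}) b = ∂_{s_1^{ℓ_1} ⋯ s_{q-1}^{ℓ_{q-1}} s_q^{j_q}} 𝔾̂_q(σ_1,…,σ_q | d^{(1)},…,d^{(q-1)}) b hold. -/
open Matrix
open scoped Kronecker

namespace StructBilin

section Calculus

variable {α β γ : Type*}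

lemma analyticAt_matrix_mul [Fintype β] {A : ℂ → Matrix α β ℂ} {B : ℂ → Matrix β γ ℂ} {z : ℂ}
    (hA : ∀ a e, AnalyticAt ℂ (fun w => A w a e) z)
    (hB : ∀ a e, AnalyticAt ℂ (fun w => B w a e) z) (a : α) (e : γ) :
    AnalyticAt ℂ (fun w => (A w * B w) a e) z := by
  simp only [Matrix.mul_apply]
  exact Finset.analyticAt_fun_sum _ fun x _ => (hA a x).mul (hB x e)

lemma analyticAt_matrix_const_mul [Fintype β] (M : Matrix α β ℂ) {A : ℂ → Matrix β γ ℂ} {z : ℂ}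
    (hA : ∀ a e, AnalyticAt ℂ (fun w => A w a e) z) (a : α) (e : γ) :
    AnalyticAt ℂ (fun w => (M * A w) a e) z :=
  analyticAt_matrix_mul (A := fun _ => M) (fun _ _ => analyticAt_const) hA a e

lemma analyticAt_matrix_mul_const [Fintype β] (M : Matrix β γ ℂ) {A : ℂ → Matrix α β ℂ} {z : ℂ}
    (hA : ∀ a e, AnalyticAt ℂ (fun w => A w a e) z) (a : α) (e : γ) :
    AnalyticAt ℂ (fun w => (A w * M) a e) z :=
  analyticAt_matrix_mul (B := fun _ => M) hA (fun _ _ => analyticAt_const) a e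

lemma analyticAt_matrix_det [Fintype α] [DecidableEq α] {A : ℂ → Matrix α α ℂ} {z : ℂ}
    (hA : ∀ a e, AnalyticAt ℂ (fun w => A w a e) z) :
    AnalyticAt ℂ (fun w => (A w).det) z := by
  simp only [Matrix.det_apply']
  exact Finset.analyticAt_fun_sum _ fun π _ => analyticAt_const.mul
    (Finset.analyticAt_fun_prod _ fun i _ => hA _ _)

lemma analyticAt_matrix_inv [Fintype α] [DecidableEq α] {A : ℂ → Matrix α α ℂ} {z : ℂ}
    (hA : ∀ a e, AnalyticAt ℂ (fun w => A w a e) z) (hz : IsUnit (A z).det) (a e : α) :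
    AnalyticAt ℂ (fun w => (A w)⁻¹ a e) z := by
  simp only [Matrix.inv_def, Matrix.smul_apply, Ring.inverse_eq_inv', smul_eq_mul,
    Matrix.adjugate_apply]
  refine ((analyticAt_matrix_det hA).inv hz.ne_zero).mul (analyticAt_matrix_det fun i j => ?_)
  by_cases h : i = e
  · subst h
    simpa using analyticAt_const
  · simpa [Matrix.updateRow_ne h] using hA i j

lemma analyticAt_Nsum {n m : ℕ} {N : Fin m → ℂ → Matrix (Fin n) (Fin n) ℂ} {z : ℂ}
    (hN : ∀ ι a e, AnalyticAt ℂ (fun w => N ι w a e) z) (d : Fin m → ℂ) (a e : Fin n) :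
    AnalyticAt ℂ (fun w => Nsum N w d a e) z := by
  simp only [Nsum, Matrix.sum_apply, Matrix.smul_apply, smul_eq_mul]
  exact Finset.analyticAt_fun_sum _ fun ι _ => analyticAt_const.mul (hN ι a e)

lemma mDeriv_congr {A B : ℂ → Matrix α β ℂ} {z : ℂ} (h : ∀ᶠ w in nhds z, A w = B w) (j : ℕ) :
    mDeriv j A z = mDeriv j B z := by
  ext a e
  exact Filter.EventuallyEq.iteratedDeriv_eq j (h.mono fun w hw => by simp [hw])

@[simp]
lemma mDeriv_zero (A : ℂ → Matrix α β ℂ) (z : ℂ) : mDeriv 0 A z = A z := by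
  ext a e
  simp [mDeriv]

lemma mDeriv_const_mul [Fintype β] (M : Matrix α β ℂ) {A : ℂ → Matrix β γ ℂ} {z : ℂ}
    (hA : ∀ a e, AnalyticAt ℂ (fun w => A w a e) z) (j : ℕ) :
    mDeriv j (fun w => M * A w) z = M * mDeriv j A z := by
  ext a e
  simp only [mDeriv, Matrix.of_apply, Matrix.mul_apply]
  have h : ∀ x, AnalyticAt ℂ (fun w => M a x * A w x e) z := fun x =>
    analyticAt_const.mul (hA x e)
  refine (iteratedDeriv_fun_sum fun x _ => (h x).contDiffAt).trans ?_
  exact Finset.sum_congr rfl fun x _ => iteratedDeriv_const_mul_field _ _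

lemma mDeriv_mul_const [Fintype β] (M : Matrix β γ ℂ) {A : ℂ → Matrix α β ℂ} {z : ℂ}
    (hA : ∀ a e, AnalyticAt ℂ (fun w => A w a e) z) (j : ℕ) :
    mDeriv j (fun w => A w * M) z = mDeriv j A z * M := by
  ext a e
  simp only [mDeriv, Matrix.of_apply, Matrix.mul_apply]
  have h : ∀ x, AnalyticAt ℂ (fun w => A w a x * M x e) z := fun x =>
    (hA a x).mul analyticAt_const
  refine (iteratedDeriv_fun_sum fun x _ => (h x).contDiffAt).trans ?_
  exact Finset.sum_congr rfl fun x _ => iteratedDeriv_mul_const_field _ _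

/-- Leibniz rule for products of matrix-valued functions. -/
lemma mDeriv_mul [Fintype β] {A : ℂ → Matrix α β ℂ} {B : ℂ → Matrix β γ ℂ} {z : ℂ}
    (hA : ∀ a e, AnalyticAt ℂ (fun w => A w a e) z)
    (hB : ∀ a e, AnalyticAt ℂ (fun w => B w a e) z) (j : ℕ) :
    mDeriv j (fun w => A w * B w) z =
      ∑ i ∈ Finset.range (j + 1), (j.choose i : ℂ) • (mDeriv i A z * mDeriv (j - i) B z) := by
  ext a e
  simp only [mDeriv, Matrix.of_apply, Matrix.mul_apply, Matrix.sum_apply, Matrix.smul_apply,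
    smul_eq_mul, Finset.mul_sum]
  have h : ∀ x, AnalyticAt ℂ (fun w => A w a x * B w x e) z := fun x => (hA a x).mul (hB x e)
  refine (iteratedDeriv_fun_sum fun x _ => (h x).contDiffAt).trans ?_
  rw [Finset.sum_comm]
  refine Finset.sum_congr rfl fun x _ => ?_
  refine (iteratedDeriv_mul (hA a x).contDiffAt (hB x e).contDiffAt).trans ?_
  simp only [mul_assoc]

lemma mDeriv_mul_mulVec [Fintype β] [Fintype γ] {A : ℂ → Matrix α β ℂ} {B : ℂ → Matrix β γ ℂ}
    {z : ℂ} (hA : ∀ a e, AnalyticAt ℂ (fun w => A w a e) z)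
    (hB : ∀ a e, AnalyticAt ℂ (fun w => B w a e) z) (j : ℕ) (b : γ → ℂ) :
    mDeriv j (fun w => A w * B w) z *ᵥ b =
      ∑ i ∈ Finset.range (j + 1),
        (j.choose i : ℂ) • (mDeriv i A z *ᵥ (mDeriv (j - i) B z *ᵥ b)) := by
  simp [mDeriv_mul hA hB, Matrix.sum_mulVec, Matrix.smul_mulVec, Matrix.mulVec_mulVec]

end Calculus

section Projection

variable {α β γ δ : Type*} [Fintype α] [Fintype β]

/-- If the derivatives of `V * Û` and `U` agree along `b`, so do those of `A * V * Û` and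
`A * U`. -/
lemma mDeriv_mul_mulVec_congr [Fintype γ] {A : ℂ → Matrix δ α ℂ} {U : ℂ → Matrix α γ ℂ}
    {U' : ℂ → Matrix β γ ℂ} {V : Matrix α β ℂ} {z : ℂ} {b : γ → ℂ} {l : ℕ}
    (hA : ∀ a e, AnalyticAt ℂ (fun w => A w a e) z)
    (hU : ∀ a e, AnalyticAt ℂ (fun w => U w a e) z)
    (hU' : ∀ a e, AnalyticAt ℂ (fun w => U' w a e) z)
    (h : ∀ j ≤ l, V *ᵥ (mDeriv j U' z *ᵥ b) = mDeriv j U z *ᵥ b) {j : ℕ} (hj : j ≤ l) :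
    mDeriv j (fun w => A w * V * U' w) z *ᵥ b = mDeriv j (fun w => A w * U w) z *ᵥ b := by
  rw [mDeriv_mul_mulVec (analyticAt_matrix_mul_const V hA) hU',
    mDeriv_mul_mulVec hA hU]
  refine Finset.sum_congr rfl fun i _ => ?_
  rw [mDeriv_mul_const V hA, ← h (j - i) (by lia), Matrix.mulVec_mulVec, Matrix.mulVec_mulVec,
    Matrix.mulVec_mulVec, Matrix.mul_assoc]

variable [DecidableEq α] [DecidableEq β]

lemma mul_inv_mul_eventually {K : ℂ → Matrix α α ℂ} {z : ℂ}
    (hK : ∀ a e, AnalyticAt ℂ (fun w => K w a e) z) (hz : IsUnit (K z).det)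
    (G : ℂ → Matrix α γ ℂ) : ∀ᶠ w in nhds z, G w = K w * ((K w)⁻¹ * G w) := by
  filter_upwards [(analyticAt_matrix_det hK).continuousAt.eventually_ne hz.ne_zero] with w hw
  rw [Matrix.mul_nonsing_inv_cancel_left _ _ (isUnit_iff_ne_zero.mpr hw)]

/-- One-variable tangential Hermite interpolation of `K⁻¹ G` by its Petrov–Galerkin projection. -/
lemma mDeriv_projection [Fintype γ] {K : ℂ → Matrix α α ℂ} {G : ℂ → Matrix α γ ℂ} {G' : ℂ → Matrix β γ ℂ}
    {V : Matrix α β ℂ} {W : Matrix β α ℂ} {z : ℂ} {b : γ → ℂ} {l : ℕ}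
    (hK : ∀ a e, AnalyticAt ℂ (fun w => K w a e) z)
    (hG : ∀ a e, AnalyticAt ℂ (fun w => G w a e) z)
    (hG' : ∀ a e, AnalyticAt ℂ (fun w => G' w a e) z)
    (hz : IsUnit (K z).det) (hz' : IsUnit (W * K z * V).det)
    (hGG' : ∀ j ≤ l, mDeriv j G' z *ᵥ b = W *ᵥ (mDeriv j G z *ᵥ b))
    (hV : ∀ j ≤ l, mDeriv j (fun w => (K w)⁻¹ * G w) z *ᵥ b ∈ Set.range V.mulVec) :
    ∀ j ≤ l, V *ᵥ (mDeriv j (fun w => (W * K w * V)⁻¹ * G' w) z *ᵥ b) =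
      mDeriv j (fun w => (K w)⁻¹ * G w) z *ᵥ b := by
  choose! y hy using hV
  have hWK : ∀ a e, AnalyticAt ℂ (fun w => (W * K w) a e) z :=
    analyticAt_matrix_const_mul W hK
  have hK' : ∀ a e, AnalyticAt ℂ (fun w => (W * K w * V) a e) z :=
    analyticAt_matrix_mul_const V hWK
  have hU := analyticAt_matrix_mul (analyticAt_matrix_inv hK hz) hG
  have hU' := analyticAt_matrix_mul (analyticAt_matrix_inv hK' hz') hG'
  suffices h : ∀ j ≤ l, mDeriv j (fun w => (W * K w * V)⁻¹ * G' w) z *ᵥ b = y j by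
    intro j hj
    rw [h j hj]
    exact hy j hj
  intro j
  induction j using Nat.strong_induction_on with
  | _ j ih =>
    intro hj
    have h := hGG' j hj
    rw [mDeriv_congr (mul_inv_mul_eventually hK' hz' G'),
      mDeriv_congr (mul_inv_mul_eventually hK hz G), mDeriv_mul_mulVec hK' hU',
      mDeriv_mul_mulVec hK hU, Matrix.mulVec_sum] at h
    have h2 : ∀ i ∈ Finset.range (j + 1),
        W *ᵥ ((j.choose i : ℂ) •
          (mDeriv i K z *ᵥ (mDeriv (j - i) (fun w => (K w)⁻¹ * G w) z *ᵥ b))) =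
        (j.choose i : ℂ) • (mDeriv i (fun w => W * K w * V) z *ᵥ y (j - i)) := by
      intro i _
      rw [mDeriv_mul_const V hWK, mDeriv_const_mul W hK, Matrix.mulVec_smul,
        ← hy (j - i) (by lia)]
      simp only [Matrix.mulVec_mulVec, Matrix.mul_assoc]
    rw [Finset.sum_congr rfl h2, Finset.sum_range_succ', Finset.sum_range_succ'] at h
    have h3 : ∀ i ∈ Finset.range j,
        (j.choose (i + 1) : ℂ) • (mDeriv (i + 1) (fun w => W * K w * V) z *ᵥ
          (mDeriv (j - (i + 1)) (fun w => (W * K w * V)⁻¹ * G' w) z *ᵥ b)) =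
        (j.choose (i + 1) : ℂ) • (mDeriv (i + 1) (fun w => W * K w * V) z *ᵥ
          y (j - (i + 1))) := by
      intro i hi
      have := Finset.mem_range.mp hi
      rw [ih (j - (i + 1)) (by lia) (by lia)]
    rw [Finset.sum_congr rfl h3] at h
    have h4 := add_left_cancel h
    simp only [Nat.choose_zero_right, Nat.cast_one, one_smul, mDeriv_zero, Nat.sub_zero] at h4
    exact Matrix.mulVec_injective_of_isUnit ((Matrix.isUnit_iff_isUnit_det _).mpr hz') h4

end Projection

section MixedDerivatives

lemma iterate_pD (i k : ℕ) (f : (ℕ → ℂ) → ℂ) (s : ℕ → ℂ) :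
    (pD i)^[k] f s = iteratedDeriv k (fun z => f (Function.update s i z)) (s i) := by
  induction k generalizing s with
  | zero => simp
  | succ k ih =>
    rw [Function.iterate_succ_apply', iteratedDeriv_succ, pD]
    simp only [ih, Function.update_idem, Function.update_self]

/-- A mixed derivative in the first `t` coordinates only sees the slice through the base point. -/
lemma mixedD_congr {o o' : ℕ → ℕ} {t : ℕ} {f g : (ℕ → ℂ) → ℂ} {σ : ℕ → ℂ}
    (ho : ∀ i < t, o i = o' i) (h : ∀ s, (∀ i, t ≤ i → s i = σ i) → f s = g s) :
    mixedD o t f σ = mixedD o' t g σ := by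
  induction t generalizing f g with
  | zero => exact h σ fun _ _ => rfl
  | succ t ih =>
    refine ih (fun i hi => ho i (by lia)) fun s hs => ?_
    rw [iterate_pD, iterate_pD, ho t (by lia)]
    congr 1
    funext z
    refine h _ fun i hi => ?_
    rw [Function.update_of_ne (by lia)]
    exact hs i (by lia)

lemma mixedD_succ_mul {α β γ : Type*} [Fintype β] (o : ℕ → ℕ) {t : ℕ} {σ : ℕ → ℂ}
    {A : ℂ → Matrix α β ℂ} (hA : ∀ a e, AnalyticAt ℂ (fun w => A w a e) (σ t))
    {H : (ℕ → ℂ) → Matrix β γ ℂ} (hH : ∀ s z, H (Function.update s t z) = H s) (a : α) (e : γ) :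
    mixedD o (t + 1) (fun s => (A (s t) * H s) a e) σ =
      mixedD o t (fun s => (mDeriv (o t) A (σ t) * H s) a e) σ := by
  rw [mixedD]
  refine mixedD_congr (fun _ _ => rfl) fun s hs => ?_
  rw [iterate_pD, hs t le_rfl, ← mDeriv_mul_const _ hA]
  simp [mDeriv, hH]

end MixedDerivatives

section Chains

variable {n m p : ℕ} {K : ℂ → Matrix (Fin n) (Fin n) ℂ} {B : ℂ → Matrix (Fin n) (Fin m) ℂ}
  {N : Fin m → ℂ → Matrix (Fin n) (Fin n) ℂ} {σ : ℕ → ℂ} {d : ℕ → Fin m → ℂ}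

lemma gAux_update {t i : ℕ} (hi : t < i) (s : ℕ → ℂ) (z : ℂ) :
    gAux K B N (Function.update s i z) d t = gAux K B N s d t := by
  induction t with
  | zero => simp only [gAux, Function.update_of_ne hi.ne]
  | succ t ih =>
    simp only [gAux, Function.update_of_ne hi.ne, ih (by lia),
      Function.update_of_ne (show t ≠ i by lia)]

/-- The right-hand side to which `K⁻¹` is applied at level `t` of the Hermite chain. -/
noncomputable def chainSource (K : ℂ → Matrix (Fin n) (Fin n) ℂ)
    (B : ℂ → Matrix (Fin n) (Fin m) ℂ) (N : Fin m → ℂ → Matrix (Fin n) (Fin n) ℂ)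
    (σ : ℕ → ℂ) (d : ℕ → Fin m → ℂ) (o : ℕ → ℕ) : ℕ → ℂ → Matrix (Fin n) (Fin m) ℂ
  | 0 => B
  | t + 1 => fun _ => hChain K B N σ d o t

lemma hChain_congr {o o' : ℕ → ℕ} {t : ℕ} (h : ∀ i ≤ t, o i = o' i) :
    hChain K B N σ d o t = hChain K B N σ d o' t := by
  induction t with
  | zero => simp only [hChain, h 0 le_rfl]
  | succ t ih => simp only [hChain, h (t + 1) le_rfl, ih fun i hi => h i (by lia)]

lemma chainSource_congr {o o' : ℕ → ℕ} {t : ℕ} (h : ∀ i < t, o i = o' i) :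
    chainSource K B N σ d o t = chainSource K B N σ d o' t := by
  cases t with
  | zero => rfl
  | succ t => simp only [chainSource, hChain_congr fun i hi => h i (Nat.lt_succ_of_le hi)]

lemma analyticAt_chainSource {o : ℕ → ℕ} {t : ℕ} {z : ℂ}
    (hB : ∀ a e, AnalyticAt ℂ (fun w => B w a e) z) (a : Fin n) (e : Fin m) :
    AnalyticAt ℂ (fun w => chainSource K B N σ d o t w a e) z := by
  cases t with
  | zero => exact hB a e
  | succ t => exact analyticAt_const

lemma hChain_eq_mDeriv {o : ℕ → ℕ} {t : ℕ}
    (hK : ∀ a e, AnalyticAt ℂ (fun w => K w a e) (σ t)) (hz : IsUnit (K (σ t)).det)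
    (hN : ∀ ι a e, AnalyticAt ℂ (fun w => N ι w a e) (σ t)) :
    hChain K B N σ d o t = mDeriv (o t)
      (fun z => Nsum N z (d t) * ((K z)⁻¹ * chainSource K B N σ d o t z)) (σ t) := by
  cases t with
  | zero => rfl
  | succ t =>
    simp only [hChain, chainSource, ← Matrix.mul_assoc]
    rw [mDeriv_mul_const _ (analyticAt_matrix_mul (analyticAt_Nsum hN _)
      (analyticAt_matrix_inv hK hz))]

lemma vHerm_eq_mDeriv {o : ℕ → ℕ} {t : ℕ}
    (hK : ∀ a e, AnalyticAt ℂ (fun w => K w a e) (σ t)) (hz : IsUnit (K (σ t)).det)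
    (b : Fin m → ℂ) (j : ℕ) :
    vHerm K B N σ d o b t j =
      mDeriv j (fun z => (K z)⁻¹ * chainSource K B N σ d o t z) (σ t) *ᵥ b := by
  cases t with
  | zero => rfl
  | succ t =>
    simp only [vHerm, chainSource]
    rw [mDeriv_mul_const _ (analyticAt_matrix_inv hK hz)]

/-- Mixed derivatives of a transfer-function chain factor into one-variable derivatives. -/
lemma mixedD_mul_gAux {o : ℕ → ℕ} {q : ℕ} {L : ℂ → Matrix (Fin p) (Fin n) ℂ}
    (hL : ∀ a e, AnalyticAt ℂ (fun w => L w a e) (σ q))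
    (hK : ∀ j ≤ q, ∀ a e, AnalyticAt ℂ (fun w => K w a e) (σ j))
    (hB : ∀ j ≤ q, ∀ a e, AnalyticAt ℂ (fun w => B w a e) (σ j))
    (hN : ∀ j ≤ q, ∀ ι a e, AnalyticAt ℂ (fun w => N ι w a e) (σ j))
    (hz : ∀ j ≤ q, IsUnit (K (σ j)).det) (a : Fin p) (e : Fin m) :
    mixedD o (q + 1) (fun s => (L (s q) * gAux K B N s d q) a e) σ =
      mDeriv (o q) (fun z => L z * ((K z)⁻¹ * chainSource K B N σ d o q z)) (σ q) a e := by
  induction q generalizing L with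
  | zero =>
    simp only [mixedD, iterate_pD, gAux, Function.update_self, mDeriv, chainSource,
      Matrix.of_apply]
  | succ t ih =>
    have hKi := analyticAt_matrix_inv (hK _ le_rfl) (hz _ le_rfl)
    have hLK := analyticAt_matrix_mul hL hKi
    have hNt := analyticAt_Nsum (hN t t.le_succ) (d t)
    have hU := analyticAt_matrix_mul hNt (analyticAt_matrix_mul
      (analyticAt_matrix_inv (hK t t.le_succ) (hz t t.le_succ))
      (analyticAt_chainSource (K := K) (N := N) (σ := σ) (d := d) (o := o) (t := t)
        (hB t t.le_succ)))
    have hL' : ∀ s : ℕ → ℂ, L (s (t + 1)) * gAux K B N s d (t + 1) =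
        (L (s (t + 1)) * (K (s (t + 1)))⁻¹) * (Nsum N (s t) (d t) * gAux K B N s d t) :=
      fun s => by simp only [gAux, Matrix.mul_assoc]
    have hR : ∀ z, L z * ((K z)⁻¹ * chainSource K B N σ d o (t + 1) z) =
        L z * (K z)⁻¹ * hChain K B N σ d o t :=
      fun z => by simp only [chainSource, Matrix.mul_assoc]
    simp only [hL', hR]
    rw [mDeriv_mul_const _ hLK, mixedD_succ_mul o hLK
      (H := fun s => Nsum N (s t) (d t) * gAux K B N s d t)
      (fun s z => by
        simp only [gAux_update (Nat.lt_succ_self t), Function.update_of_ne (Nat.lt_succ_self t).ne])]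
    simp only [← Matrix.mul_assoc]
    rw [ih (L := fun z => mDeriv (o (t + 1)) (fun w => L w * (K w)⁻¹) (σ (t + 1)) *
        Nsum N z (d t)) (analyticAt_matrix_const_mul _ hNt)
      (fun j hj => hK j (by lia)) (fun j hj => hB j (by lia)) (fun j hj => hN j (by lia))
      (fun j hj => hz j (by lia))]
    simp only [Matrix.mul_assoc]
    rw [mDeriv_const_mul _ hU, hChain_eq_mDeriv (hK t t.le_succ) (hz t t.le_succ)
      (hN t t.le_succ)]

lemma Nsum_projection {r : ℕ} (V : Matrix (Fin n) (Fin r) ℂ) (W : Matrix (Fin r) (Fin n) ℂ)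
    (z : ℂ) (e : Fin m → ℂ) :
    Nsum (fun ι s => W * N ι s * V) z e = W * (Nsum N z e * V) := by
  simp [Nsum, Matrix.sum_mul, Matrix.mul_sum, Matrix.mul_assoc]

/-- The projected chain source agrees with the projection of the chain source along `b`. -/
lemma chainSource_projection {r k : ℕ} {V : Matrix (Fin n) (Fin r) ℂ}
    {W : Matrix (Fin r) (Fin n) ℂ} {o : ℕ → ℕ} {b : Fin m → ℂ}
    (hK : ∀ j < k, ∀ a e, AnalyticAt ℂ (fun w => K w a e) (σ j))
    (hB : ∀ j < k, ∀ a e, AnalyticAt ℂ (fun w => B w a e) (σ j))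
    (hN : ∀ j < k, ∀ ι a e, AnalyticAt ℂ (fun w => N ι w a e) (σ j))
    (hz : ∀ j < k, IsUnit (K (σ j)).det) (hz' : ∀ j < k, IsUnit (W * K (σ j) * V).det)
    (hV : ∀ t < k, ∀ j ≤ o t, vHerm K B N σ d o b t j ∈ Set.range V.mulVec) :
    ∀ t < k, ∀ j ≤ o t,
      V *ᵥ (mDeriv j (fun z => (W * K z * V)⁻¹ * chainSource (fun s => W * K s * V)
        (fun s => W * B s) (fun ι s => W * N ι s * V) σ d o t z) (σ t) *ᵥ b) =
      mDeriv j (fun z => (K z)⁻¹ * chainSource K B N σ d o t z) (σ t) *ᵥ b := by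
  have hK' : ∀ j < k, ∀ a e, AnalyticAt ℂ (fun w => (W * K w * V) a e) (σ j) := fun j hj =>
    analyticAt_matrix_mul_const V (analyticAt_matrix_const_mul W (hK j hj))
  have hN' : ∀ j < k, ∀ ι a e, AnalyticAt ℂ (fun w => (W * N ι w * V) a e) (σ j) :=
    fun j hj ι => analyticAt_matrix_mul_const V (analyticAt_matrix_const_mul W (hN j hj ι))
  have hB' : ∀ j < k, ∀ a e, AnalyticAt ℂ (fun w => (W * B w) a e) (σ j) := fun j hj =>
    analyticAt_matrix_const_mul W (hB j hj)
  intro t ht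
  refine mDeriv_projection (hK t ht) (analyticAt_chainSource (hB t ht))
    (analyticAt_chainSource (hB' t ht)) (hz t ht) (hz' t ht) ?_
    (fun j hj => vHerm_eq_mDeriv (hK t ht) (hz t ht) b j ▸ hV t ht j hj)
  induction t with
  | zero =>
    intro j _
    simp only [chainSource]
    rw [mDeriv_const_mul _ (hB 0 ht), Matrix.mulVec_mulVec]
  | succ t ih =>
    have ht' : t < k := by lia
    have h := mDeriv_projection (hK t ht') (analyticAt_chainSource (hB t ht'))
      (analyticAt_chainSource (hB' t ht')) (hz t ht') (hz' t ht') (ih ht')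
      (fun j hj => vHerm_eq_mDeriv (hK t ht') (hz t ht') b j ▸ hV t ht' j hj)
    have hU := analyticAt_matrix_mul (analyticAt_matrix_inv (hK t ht') (hz t ht'))
      (analyticAt_chainSource (K := K) (N := N) (σ := σ) (d := d) (o := o) (t := t) (hB t ht'))
    have hU' := analyticAt_matrix_mul (analyticAt_matrix_inv (hK' t ht') (hz' t ht'))
      (analyticAt_chainSource (K := fun s => W * K s * V) (N := fun ι s => W * N ι s * V)
        (σ := σ) (d := d) (o := o) (t := t) (hB' t ht'))
    have hNt := analyticAt_Nsum (hN t ht') (d t)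
    have hchain : hChain (fun s => W * K s * V) (fun s => W * B s) (fun ι s => W * N ι s * V)
        σ d o t *ᵥ b = W *ᵥ (hChain K B N σ d o t *ᵥ b) := by
      rw [hChain_eq_mDeriv (hK' t ht') (hz' t ht') (hN' t ht'),
        hChain_eq_mDeriv (hK t ht') (hz t ht') (hN t ht'),
        ← mDeriv_mul_mulVec_congr hNt hU hU' h le_rfl, Matrix.mulVec_mulVec,
        ← mDeriv_const_mul W (analyticAt_matrix_mul
          (analyticAt_matrix_mul_const V hNt) hU')]
      simp only [Nsum_projection]
      simp only [Matrix.mul_assoc]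
    intro j _
    cases j with
    | zero => simpa [chainSource] using hchain
    | succ j =>
      have h0 : ∀ {q : ℕ} (M : Matrix (Fin q) (Fin m) ℂ),
          mDeriv (j + 1) (fun _ => M) (σ (t + 1)) = 0 := by
        intro q M
        ext a e
        simp [mDeriv, iteratedDeriv_const]
      simp only [chainSource, h0, Matrix.zero_mulVec, Matrix.mulVec_zero]

end Chains

theorem stmt_3 {n m p r : ℕ} (hn : 0 < n) (hm : 0 < m) (hp : 0 < p) (hr : 0 < r)
    (C : ℂ → Matrix (Fin p) (Fin n) ℂ) (K : ℂ → Matrix (Fin n) (Fin n) ℂ)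
    (B : ℂ → Matrix (Fin n) (Fin m) ℂ) (N : Fin m → ℂ → Matrix (Fin n) (Fin n) ℂ)
    (V W : Matrix (Fin n) (Fin r) ℂ)
    (k : ℕ) (hk : 0 < k) (σ : ℕ → ℂ) (d : ℕ → Fin m → ℂ) (ℓ : ℕ → ℕ) (b : Fin m → ℂ)
    (hCa : ∀ j < k, ∀ a e, AnalyticAt ℂ (fun z => C z a e) (σ j))
    (hKa : ∀ j < k, ∀ a e, AnalyticAt ℂ (fun z => K z a e) (σ j))
    (hBa : ∀ j < k, ∀ a e, AnalyticAt ℂ (fun z => B z a e) (σ j))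
    (hNa : ∀ j < k, ∀ ι a e, AnalyticAt ℂ (fun z => N ι z a e) (σ j))
    (hK : ∀ j < k, IsUnit (K (σ j)).det)
    (hKr : ∀ j < k, IsUnit (Wᴴ * K (σ j) * V).det)
    (hV : ∀ t < k, ∀ j ≤ ℓ t, vHerm K B N σ d ℓ b t j ∈ Set.range V.mulVec) :
    ∀ q < k, ∀ jq ≤ ℓ q,
      (Matrix.of fun a e =>
          mixedD (fun t => if t = q then jq else ℓ t) (q + 1)
            (fun s => Gmod C K B N s d q a e) σ) *ᵥ b =
        (Matrix.of fun a e =>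
          mixedD (fun t => if t = q then jq else ℓ t) (q + 1)
            (fun s => Gmod (fun s => C s * V) (fun s => Wᴴ * K s * V) (fun s => Wᴴ * B s) (fun ι s => Wᴴ * N ι s * V) s d q a e) σ) *ᵥ b := by
  intro q hq jq hjq
  set o : ℕ → ℕ := fun t => if t = q then jq else ℓ t
  have hoq : o q = jq := if_pos rfl
  have hol : ∀ i < q, o i = ℓ i := fun i hi => if_neg hi.ne
  have hK' : ∀ j < k, ∀ a e, AnalyticAt ℂ (fun w => (Wᴴ * K w * V) a e) (σ j) := fun j hj =>
    analyticAt_matrix_mul_const V (analyticAt_matrix_const_mul Wᴴ (hKa j hj))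
  have hN' : ∀ j < k, ∀ ι a e, AnalyticAt ℂ (fun w => (Wᴴ * N ι w * V) a e) (σ j) :=
    fun j hj ι => analyticAt_matrix_mul_const V (analyticAt_matrix_const_mul Wᴴ (hNa j hj ι))
  have hB' : ∀ j < k, ∀ a e, AnalyticAt ℂ (fun w => (Wᴴ * B w) a e) (σ j) := fun j hj =>
    analyticAt_matrix_const_mul Wᴴ (hBa j hj)
  have hC' : ∀ a e, AnalyticAt ℂ (fun w => (C w * V) a e) (σ q) :=
    analyticAt_matrix_mul_const V (hCa q hq)
  have hfull : (Matrix.of fun a e => mixedD o (q + 1) (fun s => Gmod C K B N s d q a e) σ) =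
      mDeriv jq (fun z => C z * ((K z)⁻¹ * chainSource K B N σ d ℓ q z)) (σ q) := by
    ext a e
    rw [← chainSource_congr hol, ← hoq]
    exact mixedD_mul_gAux (hCa q hq) (fun j hj => hKa j (by lia)) (fun j hj => hBa j (by lia))
      (fun j hj => hNa j (by lia)) (fun j hj => hK j (by lia)) a e
  have hred : (Matrix.of fun a e => mixedD o (q + 1) (fun s => Gmod (fun s => C s * V)
        (fun s => Wᴴ * K s * V) (fun s => Wᴴ * B s) (fun ι s => Wᴴ * N ι s * V) s d q a e) σ) =
      mDeriv jq (fun z => C z * V * ((Wᴴ * K z * V)⁻¹ * chainSource (fun s => Wᴴ * K s * V)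
        (fun s => Wᴴ * B s) (fun ι s => Wᴴ * N ι s * V) σ d ℓ q z)) (σ q) := by
    ext a e
    rw [← chainSource_congr hol, ← hoq]
    exact mixedD_mul_gAux hC' (fun j hj => hK' j (by lia)) (fun j hj => hB' j (by lia))
      (fun j hj => hN' j (by lia)) (fun j hj => hKr j (by lia)) a e
  rw [hfull, hred]
  exact (mDeriv_mul_mulVec_congr (hCa q hq)
    (analyticAt_matrix_mul (analyticAt_matrix_inv (hKa q hq) (hK q hq))
      (analyticAt_chainSource (hBa q hq)))
    (analyticAt_matrix_mul (analyticAt_matrix_inv (hK' q hq) (hKr q hq))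
      (analyticAt_chainSource (hB' q hq)))
    (chainSource_projection hKa hBa hNa hK hKr hV q hq) hjq).symm

end StructBilin
end
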